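/- For every nondegenerate triangle K in ℝ² and each cyclic permutation (i,j,k) of (0,1,2), the matrix field ψ_i belongs to Σ(K); in particular, div ψ_i is a vector field with polynomial entries of degree at most 1, i.e. div ψ_i ∈ ℙ₁(K;ℝ²). -/

import Mathlib

open MeasureTheory Matrix

noncomputable section

/-- Points of the plane ℝ². -/
abbrev V2 := Fin 2 → ℝ

/-- 2×2 real matrices. -/
abbrev Mat2 := Matrix (Fin 2) (Fin 2) ℝ

/-- The Euclidean dot product on ℝ². -/
def dot2 (x y : V2) : ℝ := x 0 * y 0 + x 1 * y 1

/-- The Euclidean norm on ℝ². -/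
def norm2 (x : V2) : ℝ := Real.sqrt (dot2 x x)

/-- Rotation by -90 degrees, used to produce a unit normal from a unit tangent. -/
def rot (x : V2) : V2 := ![x 1, -(x 0)]

/-- The closed triangle with vertices `v 0, v 1, v 2`. -/
def tri (v : Fin 3 → V2) : Set V2 := convexHull ℝ (Set.range v)

/-- `f` is (the function of) a real polynomial in two variables of total degree at most `k`. -/
def PolyDeg (k : ℕ) (f : V2 → ℝ) : Prop :=
  ∃ p : MvPolynomial (Fin 2) ℝ, p.totalDegree ≤ k ∧ ∀ x : V2, f x = MvPolynomial.eval x p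

/-- matrix-valued polynomial fields of degree at most `k`, i.e. ℙ_k(·;𝕄). -/
def IsPolyMat (k : ℕ) (τ : V2 → Mat2) : Prop := ∀ i j, PolyDeg k fun x => τ x i j

/-- vector-valued polynomial fields of degree at most `k`, i.e. ℙ_k(·;ℝ²). -/
def IsPolyVec (k : ℕ) (f : V2 → V2) : Prop := ∀ i, PolyDeg k fun x => f x i

/-- `f` agrees on `[0,1]` with a univariate polynomial of degree at most `k`
(used for restrictions to an edge, in an affine parametrization of the edge). -/
def IsPoly1 (k : ℕ) (f : ℝ → ℝ) : Prop :=
  ∃ p : Polynomial ℝ, p.natDegree ≤ k ∧ ∀ s ∈ Set.Icc (0:ℝ) 1, f s = Polynomial.eval s p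

/-- Partial derivative in the `a`-th coordinate direction. -/
def pd (f : V2 → ℝ) (a : Fin 2) : V2 → ℝ := fun x => fderiv ℝ f x (Pi.single a 1)

/-- Directional derivative of `f` in direction `w`. -/
def dirD (f : V2 → ℝ) (w : V2) (x : V2) : ℝ := fderiv ℝ f x w

/-- Row-wise divergence of a matrix-valued field. -/
def divMat (τ : V2 → Mat2) : V2 → V2 := fun x i => ∑ j, pd (fun y => τ y i j) j x

/-- The edge `e i` of the triangle, opposite to the vertex `v i`. -/
def edgeSet (v : Fin 3 → V2) (i : Fin 3) : Set V2 := segment ℝ (v (i+1)) (v (i+2))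

/-- Affine parametrization of the edge `e i` over `[0,1]`. -/
def edgePt (v : Fin 3 → V2) (i : Fin 3) (s : ℝ) : V2 := v (i+1) + s • (v (i+2) - v (i+1))

/-- The length of the edge `e i`. -/
def elen (v : Fin 3 → V2) (i : Fin 3) : ℝ := norm2 (v (i+2) - v (i+1))

/-- The unit tangent vector of the edge `e i`. -/
def tang (v : Fin 3 → V2) (i : Fin 3) : V2 := (elen v i)⁻¹ • (v (i+2) - v (i+1))

/-- The unit normal vector of the edge `e i`. -/
def nrml (v : Fin 3 → V2) (i : Fin 3) : V2 := rot (tang v i)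

/-- The arclength integral over the edge `e i`. -/
def edgeInt (v : Fin 3 → V2) (i : Fin 3) (f : V2 → ℝ) : ℝ :=
  ∫ s in (0:ℝ)..1, f (edgePt v i s) * elen v i

/-- The symmetric part of a matrix. -/
def symm2 (A : Mat2) : Mat2 := (2:ℝ)⁻¹ • (A + Aᵀ)

/-- The shape function space Σ(K) = {τ ∈ ℙ₃(K;𝕊) : div τ ∈ ℙ₁(K;ℝ²),
tᵀτn|ₑ ∈ ℙ₂(e) for each edge e}. -/
def SigmaSet (v : Fin 3 → V2) : Set (V2 → Mat2) :=
  {τ | IsPolyMat 3 τ ∧ (∀ x, (τ x).IsSymm) ∧ IsPolyVec 1 (divMat τ) ∧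
    ∀ i : Fin 3, IsPoly1 2 fun s => dot2 (tang v i) ((τ (edgePt v i s)).mulVec (nrml v i))}

/-- c_{ab} = ∇λ_a · ∇λ_b, where `g a` is the (constant) gradient of λ_a. -/
def cc (g : Fin 3 → V2) (a b : Fin 3) : ℝ := dot2 (g a) (g b)

/-- t_{ab} := v_b − v_a. -/
def tv (v : Fin 3 → V2) (a b : Fin 3) : V2 := v b - v a

/-- Outer product u ⊗ u. -/
def ot (u : V2) : Mat2 := Matrix.vecMulVec u u

/-- The matrix field ψ_i of Lemma 2.3, for the cyclic permutation (i, i+1, i+2). -/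
def psi (v : Fin 3 → V2) (lam : Fin 3 → V2 → ℝ) (g : Fin 3 → V2) (i : Fin 3) :
    V2 → Mat2 := fun x =>
  (-10 * cc g i (i+2) * lam (i+1) x * lam (i+2) x ^ 2) • ot (tv v (i+2) i)
  + (-10 * cc g i (i+1) * (lam (i+2) x + lam i x) * lam (i+1) x * lam (i+2) x) • ot (tv v i (i+1))
  + (((6 * cc g i (i+1) - 9 * cc g i (i+2)) * lam (i+1) x
      + (9 * cc g i (i+1) - 6 * cc g i (i+2)) * lam (i+2) x)
      * lam (i+1) x * lam (i+2) x) • ot (tv v (i+1) (i+2))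
  + (((6 * cc g i (i+1) - 9 * cc g i (i+2)) * lam (i+1) x
      + (2 * cc g i (i+2) - 3 * cc g i (i+1)) * lam (i+2) x)
      * lam (i+2) x * lam i x) • ot (tv v (i+2) i)
  + (((3 * cc g i (i+2) - 2 * cc g i (i+1)) * lam (i+1) x
      + (9 * cc g i (i+1) - 6 * cc g i (i+2)) * lam (i+2) x)
      * lam i x * lam (i+1) x) • ot (tv v i (i+1))

theorem PolyDeg.const (k : ℕ) (c : ℝ) : PolyDeg k fun _ => c :=
  ⟨MvPolynomial.C c, by simp, fun x => by simp⟩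

theorem PolyDeg.add {k : ℕ} {f g : V2 → ℝ} (hf : PolyDeg k f) (hg : PolyDeg k g) :
    PolyDeg k fun x => f x + g x := by
  obtain ⟨p, hp, hfp⟩ := hf
  obtain ⟨q, hq, hgq⟩ := hg
  exact ⟨p + q, (MvPolynomial.totalDegree_add p q).trans (max_le hp hq),
    fun x => by simp [hfp, hgq]⟩

theorem PolyDeg.mul {k l : ℕ} {f g : V2 → ℝ} (hf : PolyDeg k f) (hg : PolyDeg l g) :
    PolyDeg (k + l) fun x => f x * g x := by
  obtain ⟨p, hp, hfp⟩ := hf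
  obtain ⟨q, hq, hgq⟩ := hg
  exact ⟨p * q, (MvPolynomial.totalDegree_mul p q).trans (add_le_add hp hq),
    fun x => by simp [hfp, hgq]⟩

theorem PolyDeg.const_mul {k : ℕ} {f : V2 → ℝ} (c : ℝ) (hf : PolyDeg k f) :
    PolyDeg k fun x => c * f x := by
  simpa using (PolyDeg.const 0 c).mul hf

theorem PolyDeg.mul_const {k : ℕ} {f : V2 → ℝ} (hf : PolyDeg k f) (c : ℝ) :
    PolyDeg k fun x => f x * c :=
  hf.mul (PolyDeg.const 0 c)

theorem PolyDeg.affine (a : V2) (c : ℝ) : PolyDeg 1 fun x => dot2 a x + c := by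
  have hX : ∀ i : Fin 2, PolyDeg 1 fun x => x i := fun i =>
    ⟨MvPolynomial.X i, by simp, fun x => by simp⟩
  exact (((hX 0).const_mul (a 0)).add ((hX 1).const_mul (a 1))).add (PolyDeg.const 1 c)

/-- The linear functional `x ↦ a · x`. -/
def dotCLM (a : V2) : V2 →L[ℝ] ℝ :=
  a 0 • ContinuousLinearMap.proj 0 + a 1 • ContinuousLinearMap.proj 1

theorem dotCLM_apply (a x : V2) : dotCLM a x = dot2 a x := by
  simp [dotCLM, dot2]

theorem hasFDerivAt_of_affine {f : V2 → ℝ} {a : V2} (hf : ∀ x, f x = dot2 a x + f 0) (x : V2) :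
    HasFDerivAt f (dotCLM a) x := by
  have h : f = fun x => dotCLM a x + f 0 := funext fun x => by rw [dotCLM_apply, ← hf]
  rw [h]
  exact (dotCLM a).hasFDerivAt.add_const _

theorem affine_sub {f : V2 → ℝ} {a : V2} (hf : ∀ x, f x = dot2 a x + f 0) (x y : V2) :
    dot2 a (x - y) = f x - f y := by
  rw [hf x, hf y]
  simp only [dot2, Pi.sub_apply]
  ring

theorem affine_lineMap {f : V2 → ℝ} {a : V2} (hf : ∀ x, f x = dot2 a x + f 0) (x y : V2)
    (s : ℝ) : f (x + s • (y - x)) = (1 - s) * f x + s * f y := by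
  rw [hf x, hf y, hf (x + s • (y - x))]
  simp only [dot2, Pi.sub_apply, Pi.add_apply, Pi.smul_apply, smul_eq_mul]
  ring

theorem divMat_add {σ τ : V2 → Mat2} (hσ : ∀ i j, Differentiable ℝ fun x => σ x i j)
    (hτ : ∀ i j, Differentiable ℝ fun x => τ x i j) :
    divMat (fun x => σ x + τ x) = fun x => divMat σ x + divMat τ x := by
  funext x i
  simp only [divMat, pd, Pi.add_apply, Matrix.add_apply]
  rw [← Finset.sum_add_distrib]
  refine Finset.sum_congr rfl fun j _ => ?_
  rw [fderiv_fun_add (hσ i j x) (hτ i j x)]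
  rfl

theorem divMat_smul_ot {f : V2 → ℝ} (hf : Differentiable ℝ f) (u : V2) :
    divMat (fun x => f x • ot u) = fun x => dirD f u x • u := by
  funext x i
  have hu : u = u 0 • Pi.single 0 1 + u 1 • Pi.single 1 1 := by
    ext j; fin_cases j <;> simp
  have hd : dirD f u x =
      u 0 * fderiv ℝ f x (Pi.single 0 1) + u 1 * fderiv ℝ f x (Pi.single 1 1) := by
    rw [dirD]
    conv_lhs => rw [hu]
    simp
  simp only [divMat, pd, ot, Matrix.smul_apply, Matrix.vecMulVec_apply, smul_eq_mul,
    Fin.sum_univ_two, Pi.smul_apply, hd, fderiv_mul_const (hf x), _root_.smul_apply]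
  ring

theorem ot_dot_rot (u t : V2) :
    dot2 t ((ot u).mulVec (rot t)) = dot2 t u * dot2 u (rot t) := by
  simp only [dot2, ot, Matrix.mulVec, dotProduct, Fin.sum_univ_two, Matrix.vecMulVec_apply]
  ring

theorem dot2_rot_self (t : V2) : dot2 t (rot t) = 0 := by
  simp [dot2, rot]; ring

theorem dot2_smul_mulVec_rot_smul (M : Mat2) (c : ℝ) (t : V2) :
    dot2 (c • t) (M.mulVec (rot (c • t))) = c ^ 2 * dot2 t (M.mulVec (rot t)) := by
  simp [dot2, rot, Matrix.mulVec, dotProduct, Fin.sum_univ_two]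
  ring

theorem dot2_add_smul_ot_mulVec (a b c : ℝ) (r p q t : V2) :
    dot2 t ((a • ot r + b • ot p + c • ot q).mulVec (rot t)) =
      a * dot2 t ((ot r).mulVec (rot t)) + b * dot2 t ((ot p).mulVec (rot t))
        + c * dot2 t ((ot q).mulVec (rot t)) := by
  simp [dot2, Matrix.mulVec, dotProduct, Fin.sum_univ_two]
  ring

theorem edge_det_ne_zero {a b p q : V2} (hap : dot2 a p = -1) (haq : dot2 a q = 0)
    (hbq : dot2 b q = -1) : p 0 * q 1 - p 1 * q 0 ≠ 0 := by
  simp only [dot2] at *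
  intro h
  have q1 : q 1 = 0 := by linear_combination -a 0 * h + q 1 * hap - p 1 * haq
  have q0 : q 0 = 0 := by linear_combination a 1 * h + q 0 * hap - p 0 * haq
  simp [q0, q1] at hbq

theorem gradient_sum_eq_zero {a b c p q : V2}
    (hap : dot2 a p = -1) (haq : dot2 a q = 0) (hbp : dot2 b p = 1) (hbq : dot2 b q = -1)
    (hcp : dot2 c p = 0) (hcq : dot2 c q = 1) : a + b + c = 0 := by
  have hD := edge_det_ne_zero hap haq hbq
  simp only [dot2] at *
  ext l
  refine (mul_eq_zero_iff_left hD).1 ?_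
  fin_cases l
  · simp only [Fin.zero_eta, Pi.add_apply]
    linear_combination q 1 * (hap + hbp + hcp) - p 1 * (haq + hbq + hcq)
  · simp only [Fin.mk_one, Pi.add_apply]
    linear_combination -q 0 * (hap + hbp + hcp) + p 0 * (haq + hbq + hcq)

/-- Barycentric gradients `a, b, c` of a triangle with edge vectors `p = t_{ij}`, `q = t_{jk}`
satisfy `c_{ik} t_{jk}·t_{ki} = c_{ij} t_{jk}·t_{ij}`. -/
theorem dot2_gradient_mul_dot2_edge {a b c p q : V2}
    (hap : dot2 a p = -1) (haq : dot2 a q = 0) (hbp : dot2 b p = 1) (hbq : dot2 b q = -1)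
    (hcp : dot2 c p = 0) (hcq : dot2 c q = 1) :
    dot2 a c * dot2 q (-(p + q)) = dot2 a b * dot2 q p := by
  have hD0 := edge_det_ne_zero hap haq hbq
  simp only [dot2, Pi.neg_apply, Pi.add_apply] at *
  set D := p 0 * q 1 - p 1 * q 0
  have a0 : D * a 0 = -q 1 := by linear_combination q 1 * hap - p 1 * haq
  have a1 : D * a 1 = q 0 := by linear_combination -q 0 * hap + p 0 * haq
  have b0 : D * b 0 = q 1 + p 1 := by linear_combination q 1 * hbp - p 1 * hbq
  have b1 : D * b 1 = -(q 0 + p 0) := by linear_combination -q 0 * hbp + p 0 * hbq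
  have c0 : D * c 0 = -p 1 := by linear_combination q 1 * hcp - p 1 * hcq
  have c1 : D * c 1 = p 0 := by linear_combination -q 0 * hcp + p 0 * hcq
  have hac : D ^ 2 * (a 0 * c 0 + a 1 * c 1) = q 0 * p 0 + q 1 * p 1 := by
    linear_combination D * c 0 * a0 - q 1 * c0 + D * c 1 * a1 + q 0 * c1
  have hab : D ^ 2 * (a 0 * b 0 + a 1 * b 1) =
      q 0 * -(p 0 + q 0) + q 1 * -(p 1 + q 1) := by
    linear_combination D * b 0 * a0 - q 1 * b0 + D * b 1 * a1 + q 0 * b1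
  refine mul_left_cancel₀ (pow_ne_zero 2 hD0) ?_
  linear_combination (q 0 * -(p 0 + q 0) + q 1 * -(p 1 + q 1)) * hac
    - (q 0 * p 0 + q 1 * p 1) * hab

/-- The coefficient of `t_{ki} ⊗ t_{ki}` in `ψ_i`, with `x = c_{ij}` and `y = c_{ik}`. -/
def coeffKI (x y A B C : ℝ) : ℝ :=
  -10 * y * A * B ^ 2 + ((6 * x - 9 * y) * A + (2 * y - 3 * x) * B) * B * C

/-- The coefficient of `t_{ij} ⊗ t_{ij}` in `ψ_i`, with `x = c_{ij}` and `y = c_{ik}`. -/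
def coeffIJ (x y A B C : ℝ) : ℝ :=
  -10 * x * (B + C) * A * B + ((3 * y - 2 * x) * A + (9 * x - 6 * y) * B) * C * A

/-- The coefficient of `t_{jk} ⊗ t_{jk}` in `ψ_i`, with `x = c_{ij}` and `y = c_{ik}`. -/
def coeffJK (x y A B : ℝ) : ℝ :=
  ((6 * x - 9 * y) * A + (9 * x - 6 * y) * B) * A * B

theorem psi_eq (v : Fin 3 → V2) (lam : Fin 3 → V2 → ℝ) (g : Fin 3 → V2) (i : Fin 3) :
    psi v lam g i = fun x =>
      coeffKI (cc g i (i+1)) (cc g i (i+2)) (lam (i+1) x) (lam (i+2) x) (lam i x)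
          • ot (tv v (i+2) i)
        + coeffIJ (cc g i (i+1)) (cc g i (i+2)) (lam (i+1) x) (lam (i+2) x) (lam i x)
          • ot (tv v i (i+1))
        + coeffJK (cc g i (i+1)) (cc g i (i+2)) (lam (i+1) x) (lam (i+2) x)
          • ot (tv v (i+1) (i+2)) := by
  funext x
  simp only [psi, coeffKI, coeffIJ, coeffJK]
  module

theorem hasFDerivAt_coeffKI {A B C : V2 → ℝ} {a b c : V2} (x y : ℝ)
    (hA : ∀ z, A z = dot2 a z + A 0) (hB : ∀ z, B z = dot2 b z + B 0)
    (hC : ∀ z, C z = dot2 c z + C 0) (z : V2) :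
    HasFDerivAt (fun z => coeffKI x y (A z) (B z) (C z))
      ((-10 * y * B z ^ 2 + (6 * x - 9 * y) * B z * C z) • dotCLM a
        + (-20 * y * A z * B z + (6 * x - 9 * y) * A z * C z
          + 2 * (2 * y - 3 * x) * B z * C z) • dotCLM b
        + (((6 * x - 9 * y) * A z + (2 * y - 3 * x) * B z) * B z) • dotCLM c) z := by
  have dA := hasFDerivAt_of_affine hA z
  have dB := hasFDerivAt_of_affine hB z
  have dC := hasFDerivAt_of_affine hC z
  refine (((dA.const_mul (-10 * y)).mul (dB.pow 2)).add
    ((((dA.const_mul (6 * x - 9 * y)).add (dB.const_mul (2 * y - 3 * x))).mul dB).mul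
      dC)).congr_fderiv ?_
  ext w
  simp
  ring

theorem hasFDerivAt_coeffIJ {A B C : V2 → ℝ} {a b c : V2} (x y : ℝ)
    (hA : ∀ z, A z = dot2 a z + A 0) (hB : ∀ z, B z = dot2 b z + B 0)
    (hC : ∀ z, C z = dot2 c z + C 0) (z : V2) :
    HasFDerivAt (fun z => coeffIJ x y (A z) (B z) (C z))
      ((-10 * x * (B z + C z) * B z + 2 * (3 * y - 2 * x) * A z * C z
          + (9 * x - 6 * y) * B z * C z) • dotCLM a
        + (-10 * x * A z * (2 * B z + C z) + (9 * x - 6 * y) * A z * C z) • dotCLM b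
        + (-10 * x * A z * B z + ((3 * y - 2 * x) * A z + (9 * x - 6 * y) * B z) * A z)
          • dotCLM c) z := by
  have dA := hasFDerivAt_of_affine hA z
  have dB := hasFDerivAt_of_affine hB z
  have dC := hasFDerivAt_of_affine hC z
  refine (((((dB.add dC).const_mul (-10 * x)).mul dA).mul dB).add
    ((((dA.const_mul (3 * y - 2 * x)).add (dB.const_mul (9 * x - 6 * y))).mul dC).mul
      dA)).congr_fderiv ?_
  ext w
  simp
  ring

theorem hasFDerivAt_coeffJK {A B : V2 → ℝ} {a b : V2} (x y : ℝ)
    (hA : ∀ z, A z = dot2 a z + A 0) (hB : ∀ z, B z = dot2 b z + B 0) (z : V2) :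
    HasFDerivAt (fun z => coeffJK x y (A z) (B z))
      ((2 * (6 * x - 9 * y) * A z * B z + (9 * x - 6 * y) * B z ^ 2) • dotCLM a
        + ((6 * x - 9 * y) * A z ^ 2 + 2 * (9 * x - 6 * y) * A z * B z) • dotCLM b) z := by
  have dA := hasFDerivAt_of_affine hA z
  have dB := hasFDerivAt_of_affine hB z
  refine ((((dA.const_mul (6 * x - 9 * y)).add (dB.const_mul (9 * x - 6 * y))).mul dA).mul
    dB).congr_fderiv ?_
  ext w
  simp
  ring

theorem polyDeg_coeffKI {A B C : V2 → ℝ} {a b c : V2} (x y : ℝ)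
    (hA : ∀ z, A z = dot2 a z + A 0) (hB : ∀ z, B z = dot2 b z + B 0)
    (hC : ∀ z, C z = dot2 c z + C 0) : PolyDeg 3 fun z => coeffKI x y (A z) (B z) (C z) := by
  have pA : PolyDeg 1 A := funext hA ▸ PolyDeg.affine a (A 0)
  have pB : PolyDeg 1 B := funext hB ▸ PolyDeg.affine b (B 0)
  have pC : PolyDeg 1 C := funext hC ▸ PolyDeg.affine c (C 0)
  simp only [coeffKI, pow_two]
  exact ((pA.const_mul _).mul (pB.mul pB)).add
    ((((pA.const_mul _).add (pB.const_mul _)).mul pB).mul pC)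

theorem polyDeg_coeffIJ {A B C : V2 → ℝ} {a b c : V2} (x y : ℝ)
    (hA : ∀ z, A z = dot2 a z + A 0) (hB : ∀ z, B z = dot2 b z + B 0)
    (hC : ∀ z, C z = dot2 c z + C 0) : PolyDeg 3 fun z => coeffIJ x y (A z) (B z) (C z) := by
  have pA : PolyDeg 1 A := funext hA ▸ PolyDeg.affine a (A 0)
  have pB : PolyDeg 1 B := funext hB ▸ PolyDeg.affine b (B 0)
  have pC : PolyDeg 1 C := funext hC ▸ PolyDeg.affine c (C 0)
  simp only [coeffIJ]
  exact ((((pB.add pC).const_mul _).mul pA).mul pB).add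
    ((((pA.const_mul _).add (pB.const_mul _)).mul pC).mul pA)

theorem polyDeg_coeffJK {A B : V2 → ℝ} {a b : V2} (x y : ℝ)
    (hA : ∀ z, A z = dot2 a z + A 0) (hB : ∀ z, B z = dot2 b z + B 0) :
    PolyDeg 3 fun z => coeffJK x y (A z) (B z) := by
  have pA : PolyDeg 1 A := funext hA ▸ PolyDeg.affine a (A 0)
  have pB : PolyDeg 1 B := funext hB ▸ PolyDeg.affine b (B 0)
  simp only [coeffJK]
  exact (((pA.const_mul _).add (pB.const_mul _)).mul pA).mul pB

/-- The divergence of the matrix field of `ψ_i`: the quadratic terms cancel. -/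
theorem divMat_coeff_smul_ot {A B C : V2 → ℝ} {a b c p q r : V2} (x y : ℝ)
    (hA : ∀ z, A z = dot2 a z + A 0) (hB : ∀ z, B z = dot2 b z + B 0)
    (hC : ∀ z, C z = dot2 c z + C 0) (hsum : ∀ z, A z + B z + C z = 1) (hpqr : p + q + r = 0)
    (hap : dot2 a p = 1) (haq : dot2 a q = -1) (har : dot2 a r = 0)
    (hbp : dot2 b p = 0) (hbq : dot2 b q = 1) (hbr : dot2 b r = -1)
    (hcp : dot2 c p = -1) (hcr : dot2 c r = 1) :
    divMat (fun z => coeffKI x y (A z) (B z) (C z) • ot r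
        + coeffIJ x y (A z) (B z) (C z) • ot p + coeffJK x y (A z) (B z) • ot q) =
      fun z => ((-x - 6 * y) * B z + (6 * y - 4 * x) * A z) • p
        + ((9 * y - 6 * x) * A z + (6 * x - 4 * y) * B z) • r := by
  have dR : Differentiable ℝ fun z => coeffKI x y (A z) (B z) (C z) :=
    fun z => (hasFDerivAt_coeffKI x y hA hB hC z).differentiableAt
  have dP : Differentiable ℝ fun z => coeffIJ x y (A z) (B z) (C z) :=
    fun z => (hasFDerivAt_coeffIJ x y hA hB hC z).differentiableAt
  have dQ : Differentiable ℝ fun z => coeffJK x y (A z) (B z) :=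
    fun z => (hasFDerivAt_coeffJK x y hA hB z).differentiableAt
  rw [divMat_add
      (σ := fun z => coeffKI x y (A z) (B z) (C z) • ot r + coeffIJ x y (A z) (B z) (C z) • ot p)
      (τ := fun z => coeffJK x y (A z) (B z) • ot q)
      (fun i j => (dR.mul_const _).add (dP.mul_const _)) fun i j => dQ.mul_const _,
    divMat_add (σ := fun z => coeffKI x y (A z) (B z) (C z) • ot r)
      (τ := fun z => coeffIJ x y (A z) (B z) (C z) • ot p) (fun i j => dR.mul_const _)
      fun i j => dP.mul_const _,
    divMat_smul_ot dR, divMat_smul_ot dP, divMat_smul_ot dQ]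
  funext z
  have hq : q = -(p + r) := by
    rw [eq_neg_iff_add_eq_zero, ← hpqr]
    abel
  have hCz : C z = 1 - A z - B z := by linarith [hsum z]
  simp only [dirD, (hasFDerivAt_coeffKI x y hA hB hC z).fderiv,
    (hasFDerivAt_coeffIJ x y hA hB hC z).fderiv, (hasFDerivAt_coeffJK x y hA hB z).fderiv,
    _root_.add_apply, _root_.smul_apply, dotCLM_apply, smul_eq_mul,
    hap, haq, har, hbp, hbq, hbr, hcp, hcr, hCz]
  rw [hq]
  module

theorem isPoly1_zero (k : ℕ) : IsPoly1 k fun _ => 0 :=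
  ⟨0, by simp, fun s _ => by simp⟩

theorem dot2_tang_mulVec_nrml (v : Fin 3 → V2) (i : Fin 3) (M : Mat2) :
    dot2 (tang v i) (M.mulVec (nrml v i)) =
      (elen v i)⁻¹ ^ 2 * dot2 (v (i+2) - v (i+1)) (M.mulVec (rot (v (i+2) - v (i+1)))) :=
  dot2_smul_mulVec_rot_smul M _ _

/-- ψ_i ∈ Σ(K); in particular div ψ_i ∈ ℙ₁(K;ℝ²).
Here `lam` are the barycentric coordinates of the triangle (affine functions with
`lam ℓ (v m) = δ_{ℓm}`) and `g ℓ` is the constant gradient ∇λ_ℓ. -/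
theorem statement2 (v : Fin 3 → V2) (hv : AffineIndependent ℝ v)
    (lam : Fin 3 → V2 → ℝ) (g : Fin 3 → V2)
    (hlin : ∀ ℓ x, lam ℓ x = dot2 (g ℓ) x + lam ℓ 0)
    (hvert : ∀ ℓ m, lam ℓ (v m) = if ℓ = m then 1 else 0)
    (i : Fin 3) :
    psi v lam g i ∈ SigmaSet v ∧ IsPolyVec 1 (divMat (psi v lam g i)) := by
  have e11 : i + 1 + 1 = i + 2 := by rw [add_assoc]; rfl
  have e12 : i + 1 + 2 = i := by rw [add_assoc]; exact add_zero i
  have e21 : i + 2 + 1 = i := by rw [add_assoc]; exact add_zero i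
  have e22 : i + 2 + 2 = i + 1 := by rw [add_assoc]; rfl
  have n01 : i ≠ i + 1 := by fin_cases i <;> decide
  have n02 : i ≠ i + 2 := by fin_cases i <;> decide
  have n12 : i + 1 ≠ i + 2 := by fin_cases i <;> decide
  have hd : ∀ ℓ m n, dot2 (g ℓ) (tv v m n) =
      (if ℓ = n then 1 else 0) - if ℓ = m then 1 else 0 := fun ℓ m n => by
    rw [tv, affine_sub (hlin ℓ), hvert, hvert]
  set A := lam (i + 1) with hAdef
  set B := lam (i + 2) with hBdef
  set C := lam i with hCdef
  have hA : ∀ z, A z = dot2 (g (i + 1)) z + A 0 := hlin (i + 1)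
  have hB : ∀ z, B z = dot2 (g (i + 2)) z + B 0 := hlin (i + 2)
  have hC : ∀ z, C z = dot2 (g i) z + C 0 := hlin i
  set p := tv v i (i + 1) with hp
  set q := tv v (i + 1) (i + 2) with hq
  set r := tv v (i + 2) i with hr
  have hpqr : p + q + r = 0 := by simp only [hp, hq, hr, tv]; abel
  have hap : dot2 (g (i + 1)) p = 1 := by simp [hp, hd]
  have haq : dot2 (g (i + 1)) q = -1 := by simp [hq, hd]
  have har : dot2 (g (i + 1)) r = 0 := by simp [hr, hd]
  have hbp : dot2 (g (i + 2)) p = 0 := by simp [hp, hd]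
  have hbq : dot2 (g (i + 2)) q = 1 := by simp [hq, hd]
  have hbr : dot2 (g (i + 2)) r = -1 := by simp [hr, hd]
  have hcp : dot2 (g i) p = -1 := by simp [hp, hd]
  have hcq : dot2 (g i) q = 0 := by simp [hq, hd]
  have hcr : dot2 (g i) r = 1 := by simp [hr, hd]
  have hg := gradient_sum_eq_zero hcp hcq hap haq hbp hbq
  have hsum : ∀ z, A z + B z + C z = 1 := by
    have hvi : A (v i) + B (v i) + C (v i) = 1 := by simp [hAdef, hBdef, hCdef, hvert]
    intro z
    have h0 := congrFun hg 0
    have h1 := congrFun hg 1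
    rw [hA z, hB z, hC z]
    rw [hA (v i), hB (v i), hC (v i)] at hvi
    simp only [dot2, Pi.add_apply, Pi.zero_apply] at h0 h1 hvi ⊢
    linear_combination hvi + (z 0 - v i 0) * h0 + (z 1 - v i 1) * h1
  have hkey : cc g i (i + 2) * dot2 q r = cc g i (i + 1) * dot2 q p := by
    rw [eq_neg_of_add_eq_zero_right hpqr]
    exact dot2_gradient_mul_dot2_edge hcp hcq hap haq hbp hbq
  have hdiv : IsPolyVec 1 (divMat (psi v lam g i)) := by
    rw [psi_eq, divMat_coeff_smul_ot _ _ hA hB hC hsum hpqr hap haq har hbp hbq hbr hcp hcr]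
    have pA : PolyDeg 1 A := funext hA ▸ PolyDeg.affine _ (A 0)
    have pB : PolyDeg 1 B := funext hB ▸ PolyDeg.affine _ (B 0)
    exact fun l => (((pB.const_mul _).add (pA.const_mul _)).mul_const (p l)).add
      (((pA.const_mul _).add (pB.const_mul _)).mul_const (r l))
  refine ⟨⟨?_, ?_, hdiv, ?_⟩, hdiv⟩
  · rw [psi_eq]
    exact fun l m => (((polyDeg_coeffKI _ _ hA hB hC).mul_const _).add
      ((polyDeg_coeffIJ _ _ hA hB hC).mul_const _)).add
      ((polyDeg_coeffJK _ _ hA hB).mul_const _)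
  · intro x
    simp [psi_eq, Matrix.IsSymm, ot, Matrix.transpose_vecMulVec]
  · intro m
    suffices h : ∀ s, dot2 (v (m+2) - v (m+1))
        ((psi v lam g i (edgePt v m s)).mulVec (rot (v (m+2) - v (m+1)))) = 0 by
      simp only [dot2_tang_mulVec_nrml, h, mul_zero]
      exact isPoly1_zero 2
    intro s
    have hm : m = i ∨ m = i + 1 ∨ m = i + 2 := by
      clear * -
      revert i m
      decide
    have hlam : ∀ ℓ, lam ℓ (edgePt v m s) = (1 - s) * lam ℓ (v (m + 1)) + s * lam ℓ (v (m + 2)) :=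
      fun ℓ => affine_lineMap (hlin ℓ) _ _ s
    simp only [psi_eq, dot2_add_smul_ot_mulVec, ot_dot_rot, hlam, hvert]
    rcases hm with rfl | rfl | rfl
    · change _ * (dot2 q r * dot2 r (rot q)) + _ * (dot2 q p * dot2 p (rot q))
        + _ * (dot2 q q * dot2 q (rot q)) = 0
      have hrot : dot2 r (rot q) = -dot2 p (rot q) := by
        rw [eq_neg_of_add_eq_zero_right hpqr]
        simp only [dot2, rot, Pi.neg_apply, Pi.add_apply, Matrix.cons_val_zero,
          Matrix.cons_val_one]
        ring
      simp only [hrot, dot2_rot_self, coeffKI, coeffIJ, n01, n02, n12, n12.symm, if_true, if_false]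
      linear_combination 10 * (1 - s) * s ^ 2 * dot2 p (rot q) * hkey
    · rw [e11, e12]
      change _ * (dot2 r r * dot2 r (rot r)) + _ * (dot2 r p * dot2 p (rot r))
        + _ * (dot2 r q * dot2 q (rot r)) = 0
      simp only [dot2_rot_self, coeffIJ, coeffJK, n01.symm, n12, if_false]
      ring
    · rw [e21, e22]
      change _ * (dot2 p r * dot2 r (rot p)) + _ * (dot2 p p * dot2 p (rot p))
        + _ * (dot2 p q * dot2 q (rot p)) = 0
      simp only [dot2_rot_self, coeffKI, coeffJK, n02.symm, n12.symm, if_false]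
      ring
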